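/- In the moment graph of IG(k, 2n+2) (k ≥ 2), the vertices adjacent to the identity coset are exactly: (i) (1<⋯<i-1<i+1<⋯<k<j) for k < j ≤ n+1, via α = t_i - t_j; (ii) (1<⋯<i-1<i+1<⋯<k<\overline{j}) for k+1 ≤ j ≤ n+1, j ≠ i, giving \overline{j} in the range n+1 < \overline{j} ≤ \overline{k+1}, via α = t_i + t_j; (iii) (1<⋯<i-1<i+1<⋯<j-1<j+1<⋯<k<\overline{j}<\overline{i}) for 1 ≤ i < j ≤ k, via α = t_i + t_j; (iv) (1<⋯<i-1<i+1<⋯<k<\overline{i}) for 1 ≤ i ≤ k, via α = 2t_i. That is, for each α ∈ R^+ \ R^+_{P_k}, the minimal length representative of s_α W_{P_k} is as listed. -/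

import Mathlib

def bar (n : ℕ) (i : Fin (2*n+2)) : Fin (2*n+2) := ⟨2*n+1 - i, by have := i.isLt; omega⟩

def IsSigned (n : ℕ) (w : Equiv.Perm (Fin (2*n+2))) : Prop :=
  ∀ i, w (bar n i) = bar n (w i)

def IsOddSymp (n : ℕ) (w : Equiv.Perm (Fin (2*n+2))) : Prop :=
  ∀ j : Fin (2*n+2), (j : ℕ) < n+1 → (w j : ℕ) ≠ 2*n+1

def sgen (n : ℕ) (i : Fin (n+1)) : Equiv.Perm (Fin (2*n+2)) :=
  if h : (i : ℕ) < n then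
    (Equiv.swap ⟨i, by omega⟩ ⟨(i : ℕ)+1, by omega⟩) *
      (Equiv.swap ⟨2*n - i, by omega⟩ ⟨2*n+1 - i, by omega⟩)
  else Equiv.swap ⟨n, by omega⟩ ⟨n+1, by omega⟩

noncomputable def len (n : ℕ) (w : Equiv.Perm (Fin (2*n+2))) : ℕ :=
  sInf {m | ∃ l : List (Fin (n+1)), l.length = m ∧ (l.map (sgen n)).prod = w}

def WP (n k : ℕ) : Subgroup (Equiv.Perm (Fin (2*n+2))) :=
  Subgroup.closure {x | ∃ i : Fin (n+1), (i : ℕ) ≠ k - 1 ∧ x = sgen n i}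

noncomputable def IsMinRep (n k : ℕ) (w : Equiv.Perm (Fin (2*n+2))) : Prop :=
  ∀ p ∈ WP n k, len n w ≤ len n (w * p)

noncomputable def cosetLen (n k : ℕ) (w : Equiv.Perm (Fin (2*n+2))) : ℕ :=
  sInf {m | ∃ p ∈ WP n k, len n (w * p) = m}

def s2t1 (n : ℕ) : Equiv.Perm (Fin (2*n+2)) := Equiv.swap ⟨0, by omega⟩ ⟨2*n+1, by omega⟩

def st1t2 (n : ℕ) : Equiv.Perm (Fin (2*n+2)) :=
  Equiv.swap ⟨0, by omega⟩ ⟨2*n, by omega⟩ * Equiv.swap ⟨1, by omega⟩ ⟨2*n+1, by omega⟩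

/-- The reflection `s_{t_i - t_j}` (arguments are the 0-based positions of `i, j`). -/
def reflMinus (n : ℕ) (a b : Fin (2*n+2)) : Equiv.Perm (Fin (2*n+2)) :=
  Equiv.swap a b * Equiv.swap (bar n a) (bar n b)

/-- The reflection `s_{t_i + t_j}`. -/
def reflPlus (n : ℕ) (a b : Fin (2*n+2)) : Equiv.Perm (Fin (2*n+2)) :=
  Equiv.swap a (bar n b) * Equiv.swap b (bar n a)

/-- The reflection `s_{2t_i}`. -/
def reflLong (n : ℕ) (a : Fin (2*n+2)) : Equiv.Perm (Fin (2*n+2)) :=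
  Equiv.swap a (bar n a)

/-- `z` has first `k` values (1-based) given by `f` (0-based positions and value
indices). -/
def FirstVals (n k : ℕ) (hk : k ≤ 2*n+2) (z : Equiv.Perm (Fin (2*n+2)))
    (f : ℕ → ℕ) : Prop :=
  ∀ m : Fin k, (z (Fin.castLE hk m) : ℕ) = f m

set_option maxHeartbeats 4000000

lemma sgen_val (n : ℕ) (a : Fin (n+1)) (x : Fin (2*n+2)) :
    (sgen n a x : ℕ) = if (x:ℕ) = a then (a:ℕ)+1 else if (x:ℕ) = a+1 then (a:ℕ) else
      if (x:ℕ) = 2*n-a then 2*n+1-a else if (x:ℕ) = 2*n+1-a then 2*n-a else x := by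
  have ha := a.isLt
  have hx := x.isLt
  unfold sgen
  split_ifs <;> simp only [Equiv.Perm.mul_apply, Equiv.swap_apply_def, Fin.ext_iff] <;>
    split_ifs <;> (try simp only [] at *) <;> omega

lemma bar_val (n : ℕ) (x : Fin (2*n+2)) : (bar n x : ℕ) = 2*n+1-x := rfl

lemma sgen_signed (n : ℕ) (a : Fin (n+1)) : IsSigned n (sgen n a) := by
  intro x
  have ha := a.isLt
  have hx := x.isLt
  apply Fin.ext
  have hb := bar_val n x
  rw [bar_val, sgen_val, sgen_val]
  repeat' (first | omega | split)

lemma sgen_sq (n : ℕ) (a : Fin (n+1)) : sgen n a * sgen n a = 1 := by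
  ext x
  have ha := a.isLt
  have hx := x.isLt
  simp only [Equiv.Perm.mul_apply, sgen_val, Equiv.Perm.one_apply]
  split_ifs <;> omega

lemma signed_mul {n : ℕ} {u v : Equiv.Perm (Fin (2*n+2))} (hu : IsSigned n u)
    (hv : IsSigned n v) : IsSigned n (u * v) := by
  intro x
  simp only [Equiv.Perm.mul_apply]
  rw [hv, hu]

lemma bar_bar (n : ℕ) (x : Fin (2*n+2)) : bar n (bar n x) = x := by
  apply Fin.ext
  have := x.isLt
  simp only [bar_val]; omega

lemma signed_inv {n : ℕ} {u : Equiv.Perm (Fin (2*n+2))} (hu : IsSigned n u) :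
    IsSigned n u⁻¹ := by
  intro x
  rw [Equiv.Perm.inv_eq_iff_eq, hu]
  simp

lemma signed_one (n : ℕ) : IsSigned n 1 := fun _ => rfl

lemma prod_signed (n : ℕ) (l : List (Fin (n+1))) : IsSigned n (l.map (sgen n)).prod := by
  induction l with
  | nil => exact signed_one n
  | cons a t ih => simpa using signed_mul (sgen_signed n a) ih

/-- position `a` -/
def lo (n : ℕ) (a : Fin (n+1)) : Fin (2*n+2) := ⟨a, by omega⟩
/-- position `a+1` -/
def hi (n : ℕ) (a : Fin (n+1)) : Fin (2*n+2) := ⟨(a:ℕ)+1, by omega⟩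

lemma exch_comm (n : ℕ) (a j : Fin (n+1)) (v : Equiv.Perm (Fin (2*n+2))) (hv : IsSigned n v)
    (h1 : v (lo n a) < v (hi n a)) (h2 : sgen n j (v (hi n a)) < sgen n j (v (lo n a))) :
    sgen n j * v = v * sgen n a := by
  have ha := a.isLt
  have hj := j.isLt
  have hx := (v (lo n a)).isLt
  have hy := (v (hi n a)).isLt
  have hbx := congrArg Fin.val (hv (lo n a))
  have hby := congrArg Fin.val (hv (hi n a))
  rw [bar_val] at hbx hby
  have key : ((v (lo n a) : ℕ) = j ∧ (v (hi n a) : ℕ) = j + 1) ∨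
      ((v (lo n a) : ℕ) = 2*n-j ∧ (v (hi n a) : ℕ) = 2*n+1-j) := by
    rw [Fin.lt_def] at h1 h2
    simp only [sgen_val] at h2
    split_ifs at h2 <;> omega
  ext t
  have ht := t.isLt
  simp only [Equiv.Perm.mul_apply]
  by_cases e1 : t = lo n a
  · have : sgen n a t = hi n a := by
      apply Fin.ext; rw [sgen_val, e1]; simp [lo, hi]
    rw [this, e1, sgen_val]; split_ifs <;> omega
  by_cases e2 : t = hi n a
  · have : sgen n a t = lo n a := by
      apply Fin.ext; rw [sgen_val, e2]; simp [lo, hi]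
    rw [this, e2, sgen_val]; split_ifs <;> omega
  by_cases e3 : t = bar n (lo n a)
  · have : sgen n a t = bar n (hi n a) := by
      apply Fin.ext
      have hl : (lo n a : ℕ) = a := rfl
      have hh : (hi n a : ℕ) = a + 1 := rfl
      have ht2 := congrArg Fin.val e3
      rw [bar_val] at ht2
      rw [sgen_val, bar_val]
      repeat' (first | omega | split)
    rw [this, e3, sgen_val]; split_ifs <;> omega
  by_cases e4 : t = bar n (hi n a)
  · have : sgen n a t = bar n (lo n a) := by
      apply Fin.ext
      have hl : (lo n a : ℕ) = a := rfl
      have hh : (hi n a : ℕ) = a + 1 := rfl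
      have ht2 := congrArg Fin.val e4
      rw [bar_val] at ht2
      rw [sgen_val, bar_val]
      repeat' (first | omega | split)
    rw [this, e4, sgen_val]; split_ifs <;> omega
  have f1 : (v t : ℕ) ≠ v (lo n a) := fun h => e1 (v.injective (Fin.ext h))
  have f2 : (v t : ℕ) ≠ v (hi n a) := fun h => e2 (v.injective (Fin.ext h))
  have f3 : (v t : ℕ) ≠ v (bar n (lo n a)) := fun h => e3 (v.injective (Fin.ext h))
  have f4 : (v t : ℕ) ≠ v (bar n (hi n a)) := fun h => e4 (v.injective (Fin.ext h))
  have : sgen n a t = t := by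
    apply Fin.ext
    rw [Fin.ext_iff] at e1 e2 e3 e4
    simp only [bar_val, lo, hi] at e1 e2 e3 e4
    rw [sgen_val]; split_ifs <;> omega
  rw [this, sgen_val]; split_ifs <;> omega

lemma exchange (n : ℕ) (a : Fin (n+1)) (l : List (Fin (n+1)))
    (h : (l.map (sgen n)).prod (hi n a) < (l.map (sgen n)).prod (lo n a)) :
    ∃ l' : List (Fin (n+1)), l'.length + 1 = l.length ∧
      (l'.map (sgen n)).prod = (l.map (sgen n)).prod * sgen n a := by
  induction l with
  | nil => simp [lo, hi] at h
  | cons j t ih =>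
    by_cases hd : (t.map (sgen n)).prod (hi n a) < (t.map (sgen n)).prod (lo n a)
    · obtain ⟨l', h1, h2⟩ := ih hd
      exact ⟨j :: l', by simp [h1], by simp [h2, mul_assoc]⟩
    · have hne : (t.map (sgen n)).prod (lo n a) ≠ (t.map (sgen n)).prod (hi n a) := by
        intro e
        have := congrArg Fin.val ((t.map (sgen n)).prod.injective e)
        simp [lo, hi] at this
      have hlt := lt_of_le_of_ne (not_lt.mp hd) hne
      refine ⟨t, by simp, ?_⟩
      have := exch_comm n a j _ (prod_signed n t) hlt (by simpa using h)
      rw [List.map_cons, List.prod_cons, this, mul_assoc, sgen_sq, mul_one]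

lemma asc_adj {n : ℕ} {w : Equiv.Perm (Fin (2*n+2))} (hw : IsSigned n w)
    (x y : Fin (2*n+2)) (hxy : (y:ℕ) = x + 1)
    (h : ∀ a : Fin (n+1), (a:ℕ) = x ∨ (a:ℕ) + x = 2*n → (x:ℕ) ≤ n ∨ (a:ℕ) < n →
      ((x:ℕ) ≤ n → (a:ℕ) = x) → w (lo n a) < w (hi n a)) : w x < w y := by
  have hy := y.isLt
  by_cases hx : (x:ℕ) ≤ n
  · have := h ⟨x, by omega⟩ (Or.inl rfl) (Or.inl hx) (fun _ => rfl)
    have e1 : lo n ⟨x, by omega⟩ = x := rfl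
    have e2 : hi n ⟨x, by omega⟩ = y := Fin.ext (by simp [hi, hxy])
    rwa [e1, e2] at this
  · have := h ⟨2*n-x, by omega⟩ (Or.inr (by simp only []; omega))
      (Or.inr (by simp only []; omega)) (fun h => absurd h hx)
    have e1 : lo n ⟨2*n-x, by omega⟩ = bar n y :=
      Fin.ext (by simp only [lo, bar_val]; omega)
    have e2 : hi n ⟨2*n-x, by omega⟩ = bar n x :=
      Fin.ext (by simp only [hi, bar_val]; omega)
    rw [e1, e2, hw, hw, Fin.lt_def, bar_val, bar_val] at this
    rw [Fin.lt_def]; omega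

lemma perm_mono_one {m : ℕ} (p : Equiv.Perm (Fin m)) (h : StrictMono p) : p = 1 := by
  have : (p : Fin m → Fin m) = id := by
    apply (StrictMono.range_inj h strictMono_id).mp
    simp
  ext x; rw [this]; rfl

lemma prod_inv (n : ℕ) (l : List (Fin (n+1))) :
    ((l.map (sgen n)).prod)⁻¹ = (l.reverse.map (sgen n)).prod := by
  induction l with
  | nil => simp
  | cons a t ih =>
    have : (sgen n a)⁻¹ = sgen n a := inv_eq_of_mul_eq_one_left (sgen_sq n a)
    simp [ih, this]

lemma lohi_ne {n : ℕ} (w : Equiv.Perm (Fin (2*n+2))) (a : Fin (n+1)) :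
    w (lo n a) ≠ w (hi n a) := by
  intro e
  have := congrArg Fin.val (w.injective e)
  simp [lo, hi] at this

lemma is_word (n : ℕ) (w : Equiv.Perm (Fin (2*n+2))) (hw : IsSigned n w) :
    ∃ l : List (Fin (n+1)), (l.map (sgen n)).prod = w := by
  classical
  let S : Finset (Equiv.Perm (Fin (2*n+2))) :=
    Finset.univ.filter (fun v => ∃ l : List (Fin (n+1)), v = w * (l.map (sgen n)).prod)
  have hS : S.Nonempty := ⟨w, by simp only [S, Finset.mem_filter, Finset.mem_univ, true_and]; exact ⟨[], by simp⟩⟩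
  obtain ⟨v, hvS, hmin⟩ := S.exists_min_image
    (fun v => (toLex (v : Fin (2*n+2) → Fin (2*n+2)) : Lex (Fin (2*n+2) → Fin (2*n+2)))) hS
  simp only [S, Finset.mem_filter, Finset.mem_univ, true_and] at hvS hmin
  obtain ⟨l, rfl⟩ := hvS
  have hvs : IsSigned n (w * (l.map (sgen n)).prod) := signed_mul hw (prod_signed n l)
  have hasc : ∀ a : Fin (n+1), (w * (l.map (sgen n)).prod) (lo n a) <
      (w * (l.map (sgen n)).prod) (hi n a) := by
    intro a
    by_contra hcon
    have hlt := lt_of_le_of_ne (not_lt.mp hcon) (lohi_ne _ a).symm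
    have := hmin (w * (l.map (sgen n)).prod * sgen n a) ⟨l ++ [a], by simp [mul_assoc]⟩
    refine absurd this (not_le.mpr ?_)
    refine ⟨lo n a, ?_, ?_⟩
    · intro j hj
      have hj' : (j:ℕ) < a := hj
      have hja : sgen n a j = j := by
        apply Fin.ext; rw [sgen_val]; split_ifs <;> omega
      show (w * (l.map (sgen n)).prod) (sgen n a j) = (w * (l.map (sgen n)).prod) j
      rw [hja]
    · show (w * (l.map (sgen n)).prod) (sgen n a (lo n a)) < (w * (l.map (sgen n)).prod) (lo n a)
      have : sgen n a (lo n a) = hi n a := by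
        apply Fin.ext; rw [sgen_val]; simp [lo, hi]
      rw [this]; exact hlt
  have hmono : StrictMono (w * (l.map (sgen n)).prod) := by
    have : StrictMono (fun x : Fin (2*n+1+1) => (w * (l.map (sgen n)).prod) x) := by
      rw [Fin.strictMono_iff_lt_succ]
      intro i
      exact asc_adj hvs _ _ (by simp) (fun a _ _ _ => hasc a)
    exact this
  have h1 := perm_mono_one _ hmono
  refine ⟨l.reverse, ?_⟩
  rw [← prod_inv]
  exact (eq_inv_of_mul_eq_one_left h1).symm

lemma len_desc (n : ℕ) (w : Equiv.Perm (Fin (2*n+2))) (hw : IsSigned n w) (a : Fin (n+1))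
    (h : w (hi n a) < w (lo n a)) : len n (w * sgen n a) < len n w := by
  obtain ⟨l0, hl0⟩ := is_word n w hw
  have hmem : len n w ∈ {m | ∃ l : List (Fin (n+1)), l.length = m ∧ (l.map (sgen n)).prod = w} :=
    Nat.sInf_mem ⟨l0.length, l0, rfl, hl0⟩
  obtain ⟨l, hl, hp⟩ := hmem
  obtain ⟨l', h1, h2⟩ := exchange n a l (by rw [hp]; exact h)
  have : len n (w * sgen n a) ≤ l'.length := Nat.sInf_le ⟨l', rfl, by rw [h2, hp]⟩
  omega

/-- block index of a position -/
def blk (n k x : ℕ) : ℕ := if x < k then 0 else if x + k < 2*n+2 then 1 else 2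

lemma WP_props {n k : ℕ} (hk : 2 ≤ k) (hkn : k ≤ n+1) {p : Equiv.Perm (Fin (2*n+2))}
    (hp : p ∈ WP n k) : IsSigned n p ∧ ∀ x, blk n k (p x) = blk n k x := by
  unfold WP at hp
  induction hp using Subgroup.closure_induction with
  | mem x hx =>
    obtain ⟨i, hi, rfl⟩ := hx
    refine ⟨sgen_signed n i, fun x => ?_⟩
    have := i.isLt
    have := x.isLt
    rw [sgen_val]
    unfold blk
    split_ifs <;> omega
  | one => exact ⟨signed_one n, fun _ => rfl⟩
  | mul x y _ _ hx hy =>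
    exact ⟨signed_mul hx.1 hy.1, fun t => by rw [Equiv.Perm.mul_apply, hx.2, hy.2]⟩
  | inv x _ hx =>
    exact ⟨signed_inv hx.1, fun t => by rw [← hx.2 (x⁻¹ t)]; simp⟩

lemma blk_mono {n k x y : ℕ} (h : x ≤ y) : blk n k x ≤ blk n k y := by
  unfold blk; split_ifs <;> omega

lemma minrep_mono {n k : ℕ} (hk : 2 ≤ k) (hkn : k ≤ n+1) {z : Equiv.Perm (Fin (2*n+2))}
    (hz : IsSigned n z) (hm : IsMinRep n k z) (x y : Fin (2*n+2)) (hxy : x < y)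
    (hb : blk n k x = blk n k y) : z x < z y := by
  have hasc : ∀ a : Fin (n+1), (a:ℕ) ≠ k-1 → z (lo n a) < z (hi n a) := by
    intro a ha
    by_contra hcon
    have hlt := lt_of_le_of_ne (not_lt.mp hcon) (lohi_ne _ a).symm
    have h1 := len_desc n z hz a hlt
    have h2 := hm (sgen n a) (Subgroup.subset_closure ⟨a, ha, rfl⟩)
    omega
  have main : ∀ d : ℕ, ∀ y : Fin (2*n+2), (y:ℕ) = x + d + 1 → blk n k x = blk n k y →
      z x < z y := by
    intro d
    induction d with
    | zero =>
      intro y hy hb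
      refine asc_adj hz x y (by omega) (fun a h1 h2 h3 => hasc a ?_)
      have := y.isLt
      have := a.isLt
      unfold blk at hb
      split_ifs at hb <;> omega
    | succ d ih =>
      intro y hy hb
      have hyl := y.isLt
      let y' : Fin (2*n+2) := ⟨x + d + 1, by omega⟩
      have hy' : (y':ℕ) = x + d + 1 := rfl
      have b1 : blk n k x ≤ blk n k y' := blk_mono (by omega)
      have b2 : blk n k y' ≤ blk n k y := blk_mono (by omega)
      refine lt_trans (ih y' hy' (by omega)) ?_
      have hb' : blk n k y' = blk n k y := by omega
      refine asc_adj hz y' y (by omega) (fun a h1 h2 h3 => hasc a ?_)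
      have := a.isLt
      unfold blk at hb'
      split_ifs at hb' <;> omega
  rw [Fin.lt_def] at hxy
  exact main (y - x - 1) y (by omega) hb

lemma minrep_unique {n k : ℕ} (hk : 2 ≤ k) (hkn : k ≤ n+1) {z z' : Equiv.Perm (Fin (2*n+2))}
    (hz : IsSigned n z) (hm : IsMinRep n k z) (hz' : IsSigned n z') (hm' : IsMinRep n k z')
    (h : z⁻¹ * z' ∈ WP n k) : z' = z := by
  have hp := (WP_props hk hkn h).2
  have h1 : z⁻¹ * z' = 1 := by
    apply perm_mono_one
    intro x y hxy
    by_contra hcon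
    have hle := not_lt.mp hcon
    have bxy : blk n k x ≤ blk n k y := blk_mono (le_of_lt hxy)
    have byx : blk n k ((z⁻¹ * z') y) ≤ blk n k ((z⁻¹ * z') x) := blk_mono hle
    rw [hp, hp] at byx
    have hne : (z⁻¹ * z') y ≠ (z⁻¹ * z') x := fun e =>
      (ne_of_lt hxy) ((z⁻¹ * z').injective e).symm
    have a1 := minrep_mono hk hkn hz hm _ _ (lt_of_le_of_ne hle hne) (by rw [hp, hp]; omega)
    have a2 := minrep_mono hk hkn hz' hm' x y hxy (by omega)
    simp only [Equiv.Perm.mul_apply] at a1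
    rw [← Equiv.Perm.mul_apply z z⁻¹, ← Equiv.Perm.mul_apply z z⁻¹, mul_inv_cancel] at a1
    exact absurd a1 (not_lt.mpr (le_of_lt a2))
  exact (inv_mul_eq_one.mp h1).symm

lemma core (n k : ℕ) (hk : 2 ≤ k) (hkn : k ≤ n+1) (hk' : k ≤ 2*n+2)
    (u : Equiv.Perm (Fin (2*n+2)))
    (hu : IsSigned n u) (f : ℕ → ℕ) (hf : ∀ a b, a < b → b < k → f a < f b)
    (hfu : ∀ m, m < k → ∃ x : Fin (2*n+2), (x:ℕ) < k ∧ (u x : ℕ) = f m) :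
    ∃ z : Equiv.Perm (Fin (2*n+2)), IsSigned n z ∧ u⁻¹ * z ∈ WP n k ∧ IsMinRep n k z ∧
      FirstVals n k hk' z f ∧
      ∀ z' : Equiv.Perm (Fin (2*n+2)), IsSigned n z' → u⁻¹ * z' ∈ WP n k →
        IsMinRep n k z' → z' = z := by
  classical
  obtain ⟨p, hp, hmin⟩ := (Finset.univ.filter (fun p => p ∈ WP n k)).exists_min_image
    (fun p => len n (u * p)) ⟨1, by simp [one_mem]⟩
  simp only [Finset.mem_filter, Finset.mem_univ, true_and] at hp hmin
  have hps := WP_props hk hkn hp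
  have hz : IsSigned n (u * p) := signed_mul hu hps.1
  have hm : IsMinRep n k (u * p) := by
    intro q hq
    rw [mul_assoc]
    exact hmin _ (mul_mem hp hq)
  refine ⟨u * p, hz, by simpa using hp, hm, ?_, ?_⟩
  · have hq : ∀ m : Fin k, ∃ x : Fin k, ((u * p) (Fin.castLE hk' x) : ℕ) = f m := by
      intro m
      obtain ⟨x, hx, hxf⟩ := hfu m m.isLt
      have hb := (WP_props hk hkn (inv_mem hp)).2 x
      have hlt : ((p⁻¹ x : Fin (2*n+2)) : ℕ) < k := by
        unfold blk at hb
        split_ifs at hb <;> omega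
      refine ⟨⟨(p⁻¹ x : Fin (2*n+2)), hlt⟩, ?_⟩
      rw [← hxf]
      have : Fin.castLE hk' ⟨(p⁻¹ x : Fin (2*n+2)), hlt⟩ = p⁻¹ x := rfl
      rw [this]; simp
    have hzm : StrictMono (fun x : Fin k => ((u * p) (Fin.castLE hk' x) : ℕ)) := by
      intro x y hxy
      apply minrep_mono hk hkn hz hm
      · exact hxy
      · have := x.isLt
        have := y.isLt
        simp [blk]
    choose q hq using hq
    have hqm : StrictMono q := by
      intro a b hab
      apply hzm.lt_iff_lt.mp
      simp only [hq]
      exact hf a b hab b.isLt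
    have hqi : q = id := by
      apply (StrictMono.range_inj hqm strictMono_id).mp
      have := Finite.injective_iff_surjective.mp hqm.injective
      rw [this.range_eq]; simp
    intro m
    have := hq m
    rwa [hqi] at this
  · intro z' hz' hc hm'
    apply minrep_unique hk hkn hz hm hz' hm'
    have : (u * p)⁻¹ * z' = p⁻¹ * (u⁻¹ * z') := by group
    rw [this]
    exact mul_mem (inv_mem hp) hc

lemma reflMinus_val (n : ℕ) (a b : Fin (2*n+2)) (ha : (a:ℕ) ≤ n) (hb : (b:ℕ) ≤ n)
    (x : Fin (2*n+2)) : (reflMinus n a b x : ℕ) =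
      if (x:ℕ) = a then (b:ℕ) else if (x:ℕ) = b then (a:ℕ) else
      if (x:ℕ) = 2*n+1-a then 2*n+1-b else if (x:ℕ) = 2*n+1-b then 2*n+1-a else x := by
  have hx := x.isLt
  simp only [reflMinus, Equiv.Perm.mul_apply, Equiv.swap_apply_def, Fin.ext_iff]
  split_ifs <;> simp only [bar_val] at * <;> omega

lemma reflPlus_val (n : ℕ) (a b : Fin (2*n+2)) (ha : (a:ℕ) ≤ n) (hb : (b:ℕ) ≤ n)
    (hab : (a:ℕ) < b) (x : Fin (2*n+2)) : (reflPlus n a b x : ℕ) =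
      if (x:ℕ) = a then 2*n+1-b else if (x:ℕ) = b then 2*n+1-a else
      if (x:ℕ) = 2*n+1-a then (b:ℕ) else if (x:ℕ) = 2*n+1-b then (a:ℕ) else x := by
  have hx := x.isLt
  simp only [reflPlus, Equiv.Perm.mul_apply, Equiv.swap_apply_def, Fin.ext_iff]
  split_ifs <;> simp only [bar_val] at * <;> omega

lemma reflLong_val (n : ℕ) (a : Fin (2*n+2))
    (x : Fin (2*n+2)) : (reflLong n a x : ℕ) =
      if (x:ℕ) = a then 2*n+1-a else if (x:ℕ) = 2*n+1-a then (a:ℕ) else x := by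
  simp only [reflLong, Equiv.swap_apply_def, Fin.ext_iff]
  split_ifs <;> simp only [bar_val] at * <;> omega

/-- Vertices adjacent to the identity in the moment graph of `IG(k, 2n+2)` (`k ≥ 2`):
for each root `α ∈ R⁺ \ R⁺_{P_k}`, the minimal length representative of
`s_α W_{P_k}` is:
(i)   `(1 < ⋯ < î < ⋯ < k < j)` for `α = t_i - t_j`, `i ≤ k < j ≤ n+1`;
(ii)  `(1 < ⋯ < î < ⋯ < k < \overline j)` for `α = t_i + t_j`, `i ≤ k < j ≤ n+1`;
(iii) `(1 < ⋯ < î < ⋯ < ĵ < ⋯ < k < \overline j < \overline i)` for `α = t_i + t_j`,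
      `i < j ≤ k`;
(iv)  `(1 < ⋯ < î < ⋯ < k < \overline i)` for `α = 2t_i`, `i ≤ k`.
(All of `i, j, k` are 1-based; values are recorded 0-based, `\overline i` having value
index `2n+2-i`.) -/
theorem stmt19 (n k : ℕ) (hk : 2 ≤ k) (hkn : k ≤ n+1) :
    (∀ i j : ℕ, ∀ _hi : 1 ≤ i, ∀ _hik : i ≤ k, ∀ _hkj : k < j, ∀ _hj : j ≤ n+1,
      ∃ z : Equiv.Perm (Fin (2*n+2)), IsSigned n z ∧
        (reflMinus n ⟨i-1, by omega⟩ ⟨j-1, by omega⟩)⁻¹ * z ∈ WP n k ∧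
        IsMinRep n k z ∧
        FirstVals n k (by omega) z
          (fun m => if m < i-1 then m else if m+1 < k then m+1 else j-1) ∧
        ∀ z' : Equiv.Perm (Fin (2*n+2)), IsSigned n z' →
          (reflMinus n ⟨i-1, by omega⟩ ⟨j-1, by omega⟩)⁻¹ * z' ∈ WP n k →
          IsMinRep n k z' → z' = z) ∧
    (∀ i j : ℕ, ∀ _hi : 1 ≤ i, ∀ _hik : i ≤ k, ∀ _hkj : k < j, ∀ _hj : j ≤ n+1,
      ∃ z : Equiv.Perm (Fin (2*n+2)), IsSigned n z ∧
        (reflPlus n ⟨i-1, by omega⟩ ⟨j-1, by omega⟩)⁻¹ * z ∈ WP n k ∧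
        IsMinRep n k z ∧
        FirstVals n k (by omega) z
          (fun m => if m < i-1 then m else if m+1 < k then m+1 else 2*n+2-j) ∧
        ∀ z' : Equiv.Perm (Fin (2*n+2)), IsSigned n z' →
          (reflPlus n ⟨i-1, by omega⟩ ⟨j-1, by omega⟩)⁻¹ * z' ∈ WP n k →
          IsMinRep n k z' → z' = z) ∧
    (∀ i j : ℕ, ∀ _hi : 1 ≤ i, ∀ _hij : i < j, ∀ _hjk : j ≤ k,
      ∃ z : Equiv.Perm (Fin (2*n+2)), IsSigned n z ∧
        (reflPlus n ⟨i-1, by omega⟩ ⟨j-1, by omega⟩)⁻¹ * z ∈ WP n k ∧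
        IsMinRep n k z ∧
        FirstVals n k (by omega) z
          (fun m => if m < i-1 then m else if m+2 < j then m+1 else if m+2 < k then m+2
            else if m+1 < k then 2*n+2-j else 2*n+2-i) ∧
        ∀ z' : Equiv.Perm (Fin (2*n+2)), IsSigned n z' →
          (reflPlus n ⟨i-1, by omega⟩ ⟨j-1, by omega⟩)⁻¹ * z' ∈ WP n k →
          IsMinRep n k z' → z' = z) ∧
    (∀ i : ℕ, ∀ _hi : 1 ≤ i, ∀ _hik : i ≤ k,
      ∃ z : Equiv.Perm (Fin (2*n+2)), IsSigned n z ∧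
        (reflLong n ⟨i-1, by omega⟩)⁻¹ * z ∈ WP n k ∧
        IsMinRep n k z ∧
        FirstVals n k (by omega) z
          (fun m => if m < i-1 then m else if m+1 < k then m+1 else 2*n+2-i) ∧
        ∀ z' : Equiv.Perm (Fin (2*n+2)), IsSigned n z' →
          (reflLong n ⟨i-1, by omega⟩)⁻¹ * z' ∈ WP n k →
          IsMinRep n k z' → z' = z) := by
  refine ⟨?_, ?_, ?_, ?_⟩
  · intro i j hi hik hkj hj
    apply core n k hk hkn
    · intro x
      have hx := x.isLt
      apply Fin.ext
      rw [reflMinus_val n _ _ (by (try simp only []); omega) (by (try simp only []); omega), bar_val, bar_val,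
        reflMinus_val n _ _ (by (try simp only []); omega) (by (try simp only []); omega)]
      (try simp only [])
      repeat' (first | omega | split)
    · intro a b hab hb
      (try simp only [])
      repeat' (first | omega | split)
    · intro m hm
      refine ⟨⟨if m < i-1 then m else if m+1 < k then m+1 else i-1, by split_ifs <;> omega⟩, ?_, ?_⟩
      · (try simp only []); split_ifs <;> omega
      · rw [reflMinus_val n _ _ (by (try simp only []); omega) (by (try simp only []); omega)]
        (try simp only [])
        repeat' (first | omega | split)
  · intro i j hi hik hkj hj
    apply core n k hk hkn
    · intro x
      have hx := x.isLt
      apply Fin.ext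
      rw [reflPlus_val n _ _ (by (try simp only []); omega) (by (try simp only []); omega)
        (by (try simp only []); omega), bar_val, bar_val,
        reflPlus_val n _ _ (by (try simp only []); omega) (by (try simp only []); omega)
        (by (try simp only []); omega)]
      (try simp only [])
      repeat' (first | omega | split)
    · intro a b hab hb
      (try simp only [])
      repeat' (first | omega | split)
    · intro m hm
      refine ⟨⟨if m < i-1 then m else if m+1 < k then m+1 else i-1, by split_ifs <;> omega⟩, ?_, ?_⟩
      · (try simp only []); split_ifs <;> omega
      · rw [reflPlus_val n _ _ (by (try simp only []); omega) (by (try simp only []); omega)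
          (by (try simp only []); omega)]
        (try simp only [])
        repeat' (first | omega | split)
  · intro i j hi hij hjk
    apply core n k hk hkn
    · intro x
      have hx := x.isLt
      apply Fin.ext
      rw [reflPlus_val n _ _ (by (try simp only []); omega) (by (try simp only []); omega)
        (by (try simp only []); omega), bar_val, bar_val,
        reflPlus_val n _ _ (by (try simp only []); omega) (by (try simp only []); omega)
        (by (try simp only []); omega)]
      (try simp only [])
      repeat' (first | omega | split)
    · intro a b hab hb
      (try simp only [])
      repeat' (first | omega | split)
    · intro m hm
      refine ⟨⟨if m < i-1 then m else if m+2 < j then m+1 else if m+2 < k then m+2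
            else if m+1 < k then i-1 else j-1, by split_ifs <;> omega⟩, ?_, ?_⟩
      · (try simp only []); split_ifs <;> omega
      · rw [reflPlus_val n _ _ (by (try simp only []); omega) (by (try simp only []); omega)
          (by (try simp only []); omega)]
        (try simp only [])
        repeat' (first | omega | split)
  · intro i hi hik
    apply core n k hk hkn
    · intro x
      have hx := x.isLt
      apply Fin.ext
      rw [reflLong_val, bar_val, bar_val, reflLong_val]
      (try simp only [])
      repeat' (first | omega | split)
    · intro a b hab hb
      (try simp only [])
      repeat' (first | omega | split)
    · intro m hm
      refine ⟨⟨if m < i-1 then m else if m+1 < k then m+1 else i-1, by split_ifs <;> omega⟩, ?_, ?_⟩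
      · (try simp only []); split_ifs <;> omega
      · rw [reflLong_val]
        (try simp only [])
        repeat' (first | omega | split)
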